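/- Let φ : ℝ^d → ℝ be a differentiable N-function with gradient φ′, and let φ*(η) = sup_{ξ∈ℝ^d}(ξ·η − φ(ξ)) be its conjugate. Then the following two statements are equivalent: (i) φ satisfies the Δ₂-condition, i.e. there exists C > 0 such that φ(2ξ) ≤ C φ(ξ) for all ξ ∈ ℝ^d; (ii) there exists a constant C > 0 such that φ*(φ′(ξ)) ≤ C φ(ξ) for all ξ ∈ ℝ^d. -/

import Mathlib

open Filter
open scoped RealInnerProductSpace

/-- The Legendre–Fenchel conjugate `φ*(η) = sup_{ξ ∈ ℝ^d} (ξ·η − φ(ξ))` of a function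
`φ : ℝ^d → ℝ`. -/
noncomputable def conjFn {d : ℕ} (φ : EuclideanSpace ℝ (Fin d) → ℝ)
    (η : EuclideanSpace ℝ (Fin d)) : ℝ :=
  ⨆ ξ : EuclideanSpace ℝ (Fin d), (⟪ξ, η⟫ - φ ξ)

/-- The derivative of a differentiable function along a line. -/
theorem hasDerivAt_along_line {E : Type*} [NormedAddCommGroup E] [InnerProductSpace ℝ E]
    [CompleteSpace E] {φ : E → ℝ} {x v g : E} {t : ℝ} (hg : HasGradientAt φ g (x + t • v)) :
    HasDerivAt (fun s : ℝ => φ (x + s • v)) ⟪g, v⟫ t := by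
  have hline : HasDerivAt (fun s : ℝ => x + s • v) v t := by
    simpa using ((hasDerivAt_id t).smul_const v).const_add x
  have h := hg.hasFDerivAt.comp_hasDerivAt t hline
  rwa [InnerProductSpace.toDual_apply_apply] at h

/-- A convex function lies above its tangent hyperplanes. -/
theorem ConvexOn.add_inner_gradient_le {E : Type*} [NormedAddCommGroup E]
    [InnerProductSpace ℝ E] [CompleteSpace E] {φ : E → ℝ} (hφ : ConvexOn ℝ Set.univ φ)
    {x g : E} (hg : HasGradientAt φ g x) (y : E) : φ x + ⟪g, y - x⟫ ≤ φ y := by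
  have hderiv : HasDerivAt (fun s : ℝ => φ (x + s • (y - x))) ⟪g, y - x⟫ 0 :=
    hasDerivAt_along_line (by simpa using hg)
  have hconv : ConvexOn ℝ Set.univ (fun s : ℝ => φ (x + s • (y - x))) := by
    have h := hφ.comp_affineMap (AffineMap.lineMap x y : ℝ →ᵃ[ℝ] E)
    simpa [Function.comp_def, AffineMap.lineMap_apply, add_comm] using h
  have h := hconv.le_slope_of_hasDerivAt (Set.mem_univ 0) (Set.mem_univ 1) one_pos hderiv
  simp only [slope_def_field, one_smul, zero_smul, add_zero, add_sub_cancel, sub_zero,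
    div_one] at h
  linarith

/-- Equality in the Fenchel–Young inequality at the gradient of a convex function. -/
theorem conjFn_gradient {d : ℕ} {φ : EuclideanSpace ℝ (Fin d) → ℝ}
    (hφ : ConvexOn ℝ Set.univ φ) {x g : EuclideanSpace ℝ (Fin d)} (hg : HasGradientAt φ g x) :
    conjFn φ g = ⟪g, x⟫ - φ x := by
  have hle (y : EuclideanSpace ℝ (Fin d)) : ⟪y, g⟫ - φ y ≤ ⟪g, x⟫ - φ x := by
    have h := hφ.add_inner_gradient_le hg y
    rw [inner_sub_right] at h
    rw [real_inner_comm]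
    linarith
  refine le_antisymm (ciSup_le hle) ?_
  have h := le_ciSup (f := fun y => ⟪y, g⟫ - φ y) ⟨_, Set.forall_mem_range.2 hle⟩ x
  rwa [real_inner_comm] at h

/-- If `⟪φ' ξ, ξ⟫ ≤ K φ(ξ)` for all `ξ`, then `φ` grows at most by the factor `exp K` when its
argument is doubled. -/
theorem two_smul_le_exp_mul_of_inner_gradient_le {E : Type*} [NormedAddCommGroup E]
    [InnerProductSpace ℝ E] [CompleteSpace E] {φ : E → ℝ} {φ' : E → E}
    (hφ : ∀ ξ, HasGradientAt φ (φ' ξ) ξ) (hnonneg : ∀ ξ, 0 ≤ φ ξ) {K : ℝ} (hK : 0 ≤ K)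
    (h : ∀ ξ, ⟪φ' ξ, ξ⟫ ≤ K * φ ξ) (ξ : E) : φ ((2 : ℝ) • ξ) ≤ Real.exp K * φ ξ := by
  have hline (t : ℝ) : HasDerivAt (fun s : ℝ => φ (s • ξ)) ⟪φ' (t • ξ), ξ⟫ t := by
    simpa using hasDerivAt_along_line (x := 0) (v := ξ) (t := t) (by simpa using hφ (t • ξ))
  have hexp (t : ℝ) : HasDerivAt (fun s : ℝ => Real.exp (-(K * s)))
      (Real.exp (-(K * t)) * -(K * 1)) t :=
    ((hasDerivAt_id t).const_mul K).neg.exp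
  have hderiv (t : ℝ) := (hexp t).mul (hline t)
  have hanti : AntitoneOn (fun s : ℝ => Real.exp (-(K * s)) * φ (s • ξ)) (Set.Icc 1 2) := by
    refine antitoneOn_of_hasDerivWithinAt_nonpos (convex_Icc 1 2)
      (fun t _ => (hderiv t).continuousAt.continuousWithinAt)
      (fun t _ => (hderiv t).hasDerivWithinAt) fun t ht => ?_
    rw [interior_Icc] at ht
    have hgrowth : ⟪φ' (t • ξ), ξ⟫ ≤ K * φ (t • ξ) := by
      have ht' := h (t • ξ)
      rw [inner_smul_right] at ht'
      have hpos := mul_nonneg hK (hnonneg (t • ξ))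
      by_contra! hlt
      nlinarith [ht.1]
    have := mul_le_mul_of_nonneg_left hgrowth (Real.exp_pos (-(K * t))).le
    linarith
  have h12 := hanti (Set.left_mem_Icc.2 one_le_two) (Set.right_mem_Icc.2 one_le_two) one_le_two
  simp only [one_smul, mul_one] at h12
  have hmul := mul_le_mul_of_nonneg_left h12 (Real.exp_pos (K * 2)).le
  rw [← mul_assoc, ← mul_assoc, ← Real.exp_add, ← Real.exp_add, add_neg_cancel, Real.exp_zero,
    one_mul] at hmul
  rwa [show K * 2 + -K = K by ring] at hmul

/-- Let `φ : ℝ^d → ℝ` be a differentiable N-function (continuous, convex, even,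
vanishing exactly at `0`, with `φ(ξ)/|ξ| → ∞` as `|ξ| → ∞` and `φ(ξ)/|ξ| → 0` as `ξ → 0`)
with gradient `φ'`.  Then `φ` satisfies the Δ₂-condition (`∃ C > 0, φ(2ξ) ≤ C φ(ξ)` for all
`ξ`) if and only if there is a constant `C > 0` with `φ*(φ'(ξ)) ≤ C φ(ξ)` for all `ξ`. -/
theorem stmt_5 {d : ℕ} (φ : EuclideanSpace ℝ (Fin d) → ℝ)
    (φ' : EuclideanSpace ℝ (Fin d) → EuclideanSpace ℝ (Fin d))
    (hφcont : Continuous φ) (hφconv : ConvexOn ℝ Set.univ φ)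
    (hφeven : ∀ ξ, φ (-ξ) = φ ξ) (hφzero : ∀ ξ, φ ξ = 0 ↔ ξ = 0)
    (hφinfty : Tendsto (fun ξ : EuclideanSpace ℝ (Fin d) => φ ξ / ‖ξ‖)
      (comap norm atTop) atTop)
    (hφat0 : Tendsto (fun ξ : EuclideanSpace ℝ (Fin d) => φ ξ / ‖ξ‖)
      (nhdsWithin 0 {(0 : EuclideanSpace ℝ (Fin d))}ᶜ) (nhds 0))
    (hφdiff : ∀ ξ, HasGradientAt φ (φ' ξ) ξ) :
    (∃ C > 0, ∀ ξ, φ (2 • ξ) ≤ C * φ ξ) ↔ (∃ C > 0, ∀ ξ, conjFn φ (φ' ξ) ≤ C * φ ξ) := by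
  have hnonneg (ξ : EuclideanSpace ℝ (Fin d)) : 0 ≤ φ ξ := by
    have h := hφconv.2 (Set.mem_univ ξ) (Set.mem_univ (-ξ)) (by norm_num : (0 : ℝ) ≤ 1 / 2)
      (by norm_num : (0 : ℝ) ≤ 1 / 2) (by norm_num)
    rw [smul_neg, add_neg_cancel, (hφzero 0).2 rfl, hφeven, smul_eq_mul] at h
    linarith
  simp only [conjFn_gradient hφconv (hφdiff _)]
  constructor
  · rintro ⟨C, hC, h⟩
    refine ⟨C, hC, fun ξ => ?_⟩
    have htangent := hφconv.add_inner_gradient_le (hφdiff ξ) (2 • ξ)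
    rw [two_nsmul, add_sub_cancel_right, ← two_nsmul] at htangent
    linarith [h ξ, hnonneg ξ]
  · rintro ⟨C, hC, h⟩
    refine ⟨Real.exp (C + 1), Real.exp_pos _, fun ξ => ?_⟩
    rw [← Nat.cast_smul_eq_nsmul ℝ, Nat.cast_ofNat]
    exact two_smul_le_exp_mul_of_inner_gradient_le hφdiff hnonneg (by linarith)
      (fun η => by linarith [h η]) ξ
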